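/- Assume λ₁* = λ₂* = ⋯ = λ_r*, Δ > 0, η ≤ Δ²/(36·λ₁*³), X₀ ∈ R₂, and σ_r(U₀) > 0. Then there exists an absolute constant C > 0 such that for every ε > 0 and every t ≥ C·(max{1, (1/(ηΔ))·log(Δ/(4·σ_r(U₀)²))} + (1/(ηΔ))·log(200·r·λ₁*²/(η·Δ²·ε))), the iterate satisfies ‖Σ_r − X_t X_tᵀ‖_F ≤ ε. -/

import Mathlib

open Matrix

/-- The largest singular value of a real matrix. -/
noncomputable def sigmaMax {m n : ℕ} (M : Matrix (Fin m) (Fin n) ℝ) : ℝ :=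
  sSup {c : ℝ | ∃ v : EuclideanSpace ℝ (Fin n), ‖v‖ = 1 ∧
    c = ‖(EuclideanSpace.equiv (Fin m) ℝ).symm (M.mulVec ((EuclideanSpace.equiv (Fin n) ℝ) v))‖}

/-- The smallest singular value (the `n`-th largest, for a matrix with `n` columns). -/
noncomputable def sigmaMin {m n : ℕ} (M : Matrix (Fin m) (Fin n) ℝ) : ℝ :=
  sInf {c : ℝ | ∃ v : EuclideanSpace ℝ (Fin n), ‖v‖ = 1 ∧
    c = ‖(EuclideanSpace.equiv (Fin m) ℝ).symm (M.mulVec ((EuclideanSpace.equiv (Fin n) ℝ) v))‖}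

/-- Frobenius norm of a real matrix. -/
noncomputable def frobNorm {m n : ℕ} (M : Matrix (Fin m) (Fin n) ℝ) : ℝ :=
  Real.sqrt (∑ i, ∑ j, (M i j) ^ 2)

/-- Gradient descent iterates `X_{t+1} = X_t + η (Σ - X_t X_tᵀ) X_t`. -/
noncomputable def gdIter {d r : ℕ} (S : Matrix (Fin d) (Fin d) ℝ) (η : ℝ)
    (X0 : Matrix (Fin d) (Fin r) ℝ) : ℕ → Matrix (Fin d) (Fin r) ℝ
  | 0 => X0
  | t + 1 => gdIter S η X0 t +
      η • ((S - gdIter S η X0 t * (gdIter S η X0 t)ᵀ) * gdIter S η X0 t)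

/-- The top `r × r` block `U` (first `r` rows) of `X ∈ ℝ^{d×r}`. -/
def topBlock {d r : ℕ} (h : r ≤ d) (X : Matrix (Fin d) (Fin r) ℝ) :
    Matrix (Fin r) (Fin r) ℝ :=
  fun i j => X (Fin.castLE h i) j

/-- The bottom `(d-r) × r` block `J` (last `d-r` rows) of `X ∈ ℝ^{d×r}`. -/
def botBlock {d r : ℕ} (X : Matrix (Fin d) (Fin r) ℝ) :
    Matrix (Fin (d - r)) (Fin r) ℝ :=
  fun i j => X ⟨r + (i : ℕ), by have := i.isLt; omega⟩ j

/-- The region `R = {X : σ₁(X)² ≤ 2λ₁*, σ₁(J)² ≤ λ_r* − Δ/2, σ_r(U)² ≥ Δ/4}`. -/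
def inR {d r : ℕ} (h : r ≤ d) (lam1 lamr Δ : ℝ) (X : Matrix (Fin d) (Fin r) ℝ) : Prop :=
  sigmaMax X ^ 2 ≤ 2 * lam1 ∧ sigmaMax (botBlock X) ^ 2 ≤ lamr - Δ / 2 ∧
    Δ / 4 ≤ sigmaMin (topBlock h X) ^ 2

/-- The region `R₂ = {X : σ₁(X)² ≤ 2λ₁*, σ₁(J)² ≤ λ_r* − Δ/2}`. -/
def inR2 {d r : ℕ} (lam1 lamr Δ : ℝ) (X : Matrix (Fin d) (Fin r) ℝ) : Prop :=
  sigmaMax X ^ 2 ≤ 2 * lam1 ∧ sigmaMax (botBlock X) ^ 2 ≤ lamr - Δ / 2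

open ContinuousLinearMap

theorem norm_factored_step_le {F E : Type*} [NormedAddCommGroup F] [InnerProductSpace ℝ F]
    [CompleteSpace F] [NormedAddCommGroup E] [InnerProductSpace ℝ E] [CompleteSpace E]
    {Y : F →L[ℝ] E} {G : F →L[ℝ] F} {L : E →L[ℝ] E}
    {η lam μ a p : ℝ} (hη : 0 ≤ η) (hlam : 0 ≤ lam) (hηl : η * lam ≤ 1) (hp : 0 ≤ p) (ha : 0 ≤ a)
    (hG : IsSelfAdjoint G) (hGub : ∀ x, ‖G x‖ ^ 2 ≤ 2 * lam * inner ℝ (G x) x)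
    (hGlb : ∀ x, ‖Y x‖ ^ 2 + a * ‖x‖ ^ 2 ≤ inner ℝ (G x) x)
    (hY : ‖Y‖ ≤ p) (hL : ‖L‖ ≤ μ)
    (hsmall : 2 * η * (a + 2 * p ^ 2) ≤ 1) :
    ‖Y - η • Y ∘L G + η • L ∘L Y‖ ≤ p * (1 + η * μ - η * (1 - η * lam) * (p ^ 2 + a)) := by
  have hμ : 0 ≤ μ := (norm_nonneg _).trans hL
  obtain ⟨c, hc⟩ : ∃ c, c = η * (1 - η * lam) := ⟨_, rfl⟩
  have hc0 : 0 ≤ c := by rw [hc]; exact mul_nonneg hη (by linarith)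
  have hcη : c ≤ η := by rw [hc]; nlinarith [mul_nonneg hη (mul_nonneg hη hlam)]
  rw [← hc]
  have hfac : 0 ≤ 1 - 2 * c * (2 * p ^ 2 + a) := by nlinarith [sq_nonneg p]
  have hfac' : 0 ≤ 1 - c * (p ^ 2 + a) := by
    nlinarith [mul_nonneg hc0 (sq_nonneg p), mul_nonneg hc0 ha]
  rw [← ContinuousLinearMap.adjoint.norm_map]
  refine opNorm_le_bound _ (mul_nonneg hp (by nlinarith [mul_nonneg hη hμ])) fun w => ?_
  have hYadj : ∀ w, ‖adjoint Y w‖ ≤ p * ‖w‖ := fun w =>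
    (adjoint Y).le_of_opNorm_le ((adjoint.norm_map Y).trans_le hY) w
  have hLadj : ‖adjoint L w‖ ≤ μ * ‖w‖ :=
    (adjoint L).le_of_opNorm_le ((adjoint.norm_map L).trans_le hL) w
  have key : ‖adjoint Y w - η • G (adjoint Y w)‖ ≤ p * (1 - c * (p ^ 2 + a)) * ‖w‖ := by
    rcases (norm_nonneg w).eq_or_lt with hw | hw
    · have : w = 0 := norm_eq_zero.1 hw.symm
      simp [this]
    set x := adjoint Y w with hx
    have hxw : ‖x‖ ^ 2 ≤ ‖Y x‖ * ‖w‖ := by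
      rw [← real_inner_self_eq_norm_sq, hx, adjoint_inner_right]
      exact real_inner_le_norm _ _
    have hsq : ‖x - η • G x‖ ^ 2 ≤ ‖x‖ ^ 2 - 2 * c * (‖Y x‖ ^ 2 + a * ‖x‖ ^ 2) := by
      rw [norm_sub_sq_real, real_inner_smul_right, real_inner_comm, norm_smul, mul_pow,
        Real.norm_of_nonneg hη]
      have h1 := mul_le_mul_of_nonneg_left (hGub x) (sq_nonneg η)
      have h2 := mul_le_mul_of_nonneg_left (hGlb x) hc0
      rw [hc] at h2 ⊢
      nlinarith
    have hX := hYadj w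
    rw [← hx] at hX
    have hX2 : ‖x‖ ^ 2 ≤ p ^ 2 * ‖w‖ ^ 2 := by
      rw [← mul_pow]; gcongr
    have hX4 : (‖x‖ ^ 2) ^ 2 ≤ ‖Y x‖ ^ 2 * ‖w‖ ^ 2 := by
      rw [← mul_pow]; gcongr
    generalize ‖x‖ ^ 2 = X at *
    generalize ‖Y x‖ ^ 2 = Z at *
    refine le_of_sq_le_sq ?_ (by positivity)
    have hn : 0 < ‖w‖ ^ 2 := by positivity
    generalize ‖x - η • G x‖ ^ 2 = R at *
    have hXX : 0 ≤ (p ^ 2 * ‖w‖ ^ 2 - X) *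
        (‖w‖ ^ 2 * (1 - 2 * c * a) - 2 * c * (p ^ 2 * ‖w‖ ^ 2 + X)) := by
      apply mul_nonneg (by linarith)
      nlinarith
    have h3 : R * ‖w‖ ^ 2 ≤ (p * (1 - c * (p ^ 2 + a)) * ‖w‖) ^ 2 * ‖w‖ ^ 2 := by
      have h4 := mul_le_mul_of_nonneg_right hsq hn.le
      have h5 := mul_le_mul_of_nonneg_left hX4 hc0
      have h6 : 0 ≤ (p * (c * (p ^ 2 + a)) * ‖w‖ ^ 2) ^ 2 := sq_nonneg _
      nlinarith
    exact le_of_mul_le_mul_right h3 hn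
  have hexp : adjoint (Y - η • Y ∘L G + η • L ∘L Y) w =
      (adjoint Y w - η • G (adjoint Y w)) + η • adjoint Y (adjoint L w) := by
    simp [adjoint_comp, hG.adjoint_eq]
  rw [hexp]
  calc _ ≤ ‖adjoint Y w - η • G (adjoint Y w)‖ + η * ‖adjoint Y (adjoint L w)‖ := by
        refine (norm_add_le _ _).trans ?_
        rw [norm_smul, Real.norm_of_nonneg hη]
    _ ≤ p * (1 - c * (p ^ 2 + a)) * ‖w‖ + η * (p * (μ * ‖w‖)) := by
        gcongr
        exact (hYadj _).trans (by gcongr)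
    _ = _ := by ring

theorem norm_sq_apply_le {F : Type*} [NormedAddCommGroup F] [InnerProductSpace ℝ F]
    {B : F →L[ℝ] F} {c : ℝ} (hc : 0 ≤ c)
    (hB : ∀ x y, inner ℝ (B x) y = inner ℝ x (B y))
    (h0 : ∀ x, 0 ≤ inner ℝ (B x) x) (h1 : ∀ x, inner ℝ (B x) x ≤ c * ‖x‖ ^ 2) (x : F) :
    ‖B x‖ ^ 2 ≤ c * inner ℝ (B x) x := by
  have h' := h1 (B x)
  rcases hc.eq_or_lt with rfl | hc
  · have h := h0 (x - B x)
    have h1x := h1 x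
    simp only [map_sub, inner_sub_left, inner_sub_right, hB (B x) x,
      real_inner_self_eq_norm_sq] at h
    linarith
  have h := h0 (c • x - B x)
  simp only [map_sub, map_smul, inner_sub_left, inner_sub_right, real_inner_smul_left,
    real_inner_smul_right, hB (B x) x, real_inner_self_eq_norm_sq] at h
  nlinarith

theorem norm_sq_comp_adjoint_le {F E : Type*} [NormedAddCommGroup F] [InnerProductSpace ℝ F]
    [CompleteSpace F] [NormedAddCommGroup E] [InnerProductSpace ℝ E] [CompleteSpace E]
    {U : F →L[ℝ] E} {a b : ℝ} (hab : a ≤ b) (ha : ∀ v, a * ‖v‖ ^ 2 ≤ ‖adjoint U v‖ ^ 2)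
    (hb : ∀ v, ‖adjoint U v‖ ^ 2 ≤ b * ‖v‖ ^ 2) (v : E) :
    ‖U (adjoint U v)‖ ^ 2 ≤ (a + b) * ‖adjoint U v‖ ^ 2 - a * b * ‖v‖ ^ 2 := by
  have hA : ∀ x y, inner ℝ (U (adjoint U x)) y = inner ℝ (adjoint U x) (adjoint U y) :=
    fun x y => (adjoint_inner_right U _ _).symm
  have h := norm_sq_apply_le (B := U ∘L adjoint U - a • ContinuousLinearMap.id ℝ E)
    (c := b - a) (by linarith)
    (fun x y => by
      simp [inner_sub_left, inner_sub_right, real_inner_smul_left, real_inner_smul_right, hA,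
        adjoint_inner_left])
    (fun x => by
      have := ha x
      simp [inner_sub_left, real_inner_smul_left, hA]
      linarith)
    (fun x => by
      have := hb x
      simp [inner_sub_left, real_inner_smul_left, hA]
      linarith) v
  simp [norm_sub_sq_real, inner_sub_left, real_inner_smul_left, real_inner_smul_right, norm_smul,
    mul_pow, hA] at h
  nlinarith

theorem le_norm_sq_adjoint_step {F E : Type*} [NormedAddCommGroup F] [InnerProductSpace ℝ F]
    [CompleteSpace F] [NormedAddCommGroup E] [InnerProductSpace ℝ E] [CompleteSpace E]
    {U : F →L[ℝ] E} {G : F →L[ℝ] F} {η lam a j : ℝ} (hη : 0 ≤ η) (hab : a ≤ 2 * lam)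
    (hG : IsSelfAdjoint G) (ha : ∀ v, a * ‖v‖ ^ 2 ≤ ‖adjoint U v‖ ^ 2)
    (hb : ∀ v, ‖adjoint U v‖ ^ 2 ≤ 2 * lam * ‖v‖ ^ 2)
    (hGub : ∀ x, inner ℝ (G x) x ≤ ‖U x‖ ^ 2 + j * ‖x‖ ^ 2)
    (hsmall : 2 * η * (lam + j + a) ≤ 1) (v : E) :
    a * (1 + 2 * η * (lam - j - a)) * ‖v‖ ^ 2 ≤
      ‖adjoint ((1 + η * lam) • U - η • U ∘L G) v‖ ^ 2 := by
  have hexp : adjoint ((1 + η * lam) • U - η • U ∘L G) v =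
      adjoint U v + η • (lam • adjoint U v - G (adjoint U v)) := by
    simp [adjoint_comp, hG.adjoint_eq]
    module
  rw [hexp, norm_add_sq_real, real_inner_smul_right, inner_sub_right, real_inner_smul_right,
    real_inner_self_eq_norm_sq, real_inner_comm]
  have h1 := norm_sq_comp_adjoint_le hab ha hb v
  have h2 := mul_le_mul_of_nonneg_left (hGub (adjoint U v)) hη
  have h3 := mul_le_mul_of_nonneg_left h1 hη
  have h4 := mul_le_mul_of_nonneg_left (ha v) (sub_nonneg.2 hsmall)
  have h5 := sq_nonneg ‖η • (lam • adjoint U v - G (adjoint U v))‖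
  nlinarith

theorem norm_residual_step_le {F E E' : Type*} [NormedAddCommGroup F] [InnerProductSpace ℝ F]
    [CompleteSpace F] [NormedAddCommGroup E] [InnerProductSpace ℝ E] [CompleteSpace E]
    [NormedAddCommGroup E'] [InnerProductSpace ℝ E'] [CompleteSpace E']
    {U : F →L[ℝ] E} {J : F →L[ℝ] E'} {η lam a j : ℝ} (hη : 0 ≤ η) (hlam : 0 ≤ lam)
    (hηl : η * lam ≤ 1 / 36) (hal : a ≤ 2 * lam)
    (ha : ∀ v, a * ‖v‖ ^ 2 ≤ ‖adjoint U v‖ ^ 2)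
    (hb : ‖U‖ ^ 2 ≤ 2 * lam) (hj : ‖J‖ ^ 2 ≤ j) (hjl : j ≤ lam) :
    ‖lam • ContinuousLinearMap.id ℝ E -
      ((1 + η * lam) • U - η • U ∘L (adjoint U ∘L U + adjoint J ∘L J)) ∘L
        adjoint ((1 + η * lam) • U - η • U ∘L (adjoint U ∘L U + adjoint J ∘L J))‖ ≤
      (1 - η * a) * ‖lam • ContinuousLinearMap.id ℝ E - U ∘L adjoint U‖ + 5 * η * lam * j := by
  have hj0 : 0 ≤ j := (sq_nonneg _).trans hj
  have hUadj : ∀ v, ‖adjoint U v‖ ^ 2 ≤ 2 * lam * ‖v‖ ^ 2 := fun v => by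
    have := (adjoint U).le_opNorm v
    rw [adjoint.norm_map] at this
    calc ‖adjoint U v‖ ^ 2 ≤ (‖U‖ * ‖v‖) ^ 2 := by gcongr
      _ = ‖U‖ ^ 2 * ‖v‖ ^ 2 := by ring
      _ ≤ _ := by gcongr
  have hUapp : ∀ v, ‖U v‖ ^ 2 ≤ 2 * lam * ‖v‖ ^ 2 := fun v => by
    calc ‖U v‖ ^ 2 ≤ (‖U‖ * ‖v‖) ^ 2 := by gcongr; exact U.le_opNorm v
      _ = ‖U‖ ^ 2 * ‖v‖ ^ 2 := by ring
      _ ≤ _ := by gcongr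
  have hA : ∀ x y, inner ℝ (U (adjoint U x)) y = inner ℝ (adjoint U x) (adjoint U y) :=
    fun x y => (adjoint_inner_right U _ _).symm
  obtain ⟨A, hAdef⟩ : ∃ A, A = U ∘L adjoint U := ⟨_, rfl⟩
  obtain ⟨S, hS⟩ : ∃ S, S = ContinuousLinearMap.id ℝ E - (2 * η + η ^ 2 * lam) • A
    + η ^ 2 • A ∘L A := ⟨_, rfl⟩
  obtain ⟨H, hH⟩ : ∃ H, H = adjoint J ∘L J := ⟨_, rfl⟩
  obtain ⟨N, hN⟩ : ∃ N, N = (1 + η * lam) • ContinuousLinearMap.id ℝ F -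
    η • adjoint U ∘L U := ⟨_, rfl⟩
  have hc : 0 ≤ 1 - η * a := by nlinarith
  have hSnorm : ‖S‖ ≤ 1 - η * a := by
    have hquad : ∀ v, inner ℝ (S v) v = ‖v‖ ^ 2 - (2 * η + η ^ 2 * lam) * ‖adjoint U v‖ ^ 2
        + η ^ 2 * ‖U (adjoint U v)‖ ^ 2 := fun v => by
      simp [hS, hAdef, inner_sub_left, inner_add_left, real_inner_smul_left, hA,
        adjoint_inner_left]
    have hub : ∀ v, inner ℝ (S v) v ≤ (1 - η * a) * ‖v‖ ^ 2 := fun v => by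
      have h1 := mul_le_mul_of_nonneg_left (hUapp (adjoint U v)) (sq_nonneg η)
      have h2 := mul_le_mul_of_nonneg_left (ha v) hη
      have h3 : 0 ≤ η * (1 - η * lam) * ‖adjoint U v‖ ^ 2 := by
        have : 0 ≤ 1 - η * lam := by linarith
        positivity
      rw [hquad]
      nlinarith
    refine opNorm_le_bound _ hc fun v => ?_
    refine le_of_sq_le_sq ?_ (by positivity)
    have h := norm_sq_apply_le hc (B := S) (fun x y => by
      simp [hS, hAdef, inner_sub_left, inner_sub_right, inner_add_left, inner_add_right,
        real_inner_smul_left, real_inner_smul_right, hA, adjoint_inner_left]) (fun v => by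
      have h1 := mul_le_mul_of_nonneg_left (hUadj v)
        (show 0 ≤ 2 * η + η ^ 2 * lam by positivity)
      have h2 : 0 ≤ ‖v‖ ^ 2 * (1 - (2 * η + η ^ 2 * lam) * (2 * lam)) := by
        apply mul_nonneg (sq_nonneg _)
        nlinarith [mul_nonneg hη hlam]
      rw [hquad]
      nlinarith [mul_nonneg (sq_nonneg η) (sq_nonneg ‖U (adjoint U v)‖)]) hub v
    nlinarith [mul_le_mul_of_nonneg_left (hub v) hc]
  have hHnorm : ‖H‖ ≤ j := by
    rw [hH, ContinuousLinearMap.norm_adjoint_comp_self, ← sq]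
    exact hj
  have hNnorm : ‖N‖ ≤ 13 / 12 := by
    rw [hN]
    refine (norm_sub_le _ _).trans ?_
    rw [norm_smul, norm_smul, ContinuousLinearMap.norm_adjoint_comp_self, ← sq,
      Real.norm_of_nonneg hη, Real.norm_of_nonneg (show 0 ≤ 1 + η * lam by positivity)]
    have h1 := ContinuousLinearMap.norm_id_le (𝕜 := ℝ) (E := F)
    have h2 := mul_le_mul_of_nonneg_left h1 (show 0 ≤ 1 + η * lam by positivity)
    nlinarith [mul_le_mul_of_nonneg_left hb hη]
  obtain ⟨R, hR⟩ : ∃ R, R = η • (N ∘L H + H ∘L N) - η ^ 2 • H ∘L H := ⟨_, rfl⟩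
  have hRnorm : ‖R‖ ≤ 5 / 2 * η * j := by
    have h1 : ‖N ∘L H‖ ≤ 13 / 12 * j := (opNorm_comp_le _ _).trans (by gcongr)
    have h2 : ‖H ∘L N‖ ≤ j * (13 / 12) := (opNorm_comp_le _ _).trans (by gcongr)
    have h3 : ‖H ∘L H‖ ≤ j * j := (opNorm_comp_le _ _).trans (by gcongr)
    calc ‖R‖ ≤ η * (‖N ∘L H‖ + ‖H ∘L N‖) + η ^ 2 * ‖H ∘L H‖ := by
          rw [hR]
          refine (norm_sub_le _ _).trans ?_
          rw [norm_smul, norm_smul, Real.norm_of_nonneg hη, Real.norm_of_nonneg (sq_nonneg η)]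
          gcongr
          exact norm_add_le _ _
      _ ≤ η * (13 / 12 * j + j * (13 / 12)) + η ^ 2 * (j * j) := by gcongr
      _ ≤ 5 / 2 * η * j := by
          have : η * j ≤ 1 / 36 := (mul_le_mul_of_nonneg_left hjl hη).trans hηl
          nlinarith [mul_nonneg hη hj0]
  have hdecomp : lam • ContinuousLinearMap.id ℝ E -
      ((1 + η * lam) • U - η • U ∘L (adjoint U ∘L U + adjoint J ∘L J)) ∘L
        adjoint ((1 + η * lam) • U - η • U ∘L (adjoint U ∘L U + adjoint J ∘L J)) =
      S ∘L (lam • ContinuousLinearMap.id ℝ E - U ∘L adjoint U) + U ∘L R ∘L adjoint U := by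
    ext v
    simp [hS, hR, hN, hH, hAdef, adjoint_comp]
    module
  have hURU : ‖U ∘L R ∘L adjoint U‖ ≤ 5 * η * lam * j := by
    calc _ ≤ ‖U‖ * (‖R‖ * ‖adjoint U‖) := (opNorm_comp_le _ _).trans (by
          gcongr; exact opNorm_comp_le _ _)
      _ = ‖U‖ ^ 2 * ‖R‖ := by rw [adjoint.norm_map]; ring
      _ ≤ 2 * lam * (5 / 2 * η * j) := by gcongr
      _ = _ := by ring
  rw [hdecomp]
  refine (norm_add_le _ _).trans (add_le_add ((opNorm_comp_le _ _).trans ?_) hURU)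
  gcongr

theorem le_norm_sq_adjoint_of_le_norm_sq {F : Type*} [NormedAddCommGroup F]
    [InnerProductSpace ℝ F] [FiniteDimensional ℝ F] [CompleteSpace F] {U : F →L[ℝ] F} {a : ℝ}
    (ha0 : 0 < a) (ha : ∀ x, a * ‖x‖ ^ 2 ≤ ‖U x‖ ^ 2) (v : F) :
    a * ‖v‖ ^ 2 ≤ ‖adjoint U v‖ ^ 2 := by
  have hinj : Function.Injective (U : F →ₗ[ℝ] F) := by
    refine (injective_iff_map_eq_zero _).2 fun x hx => ?_
    have h := ha x
    have hx' : U x = 0 := hx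
    rw [hx', norm_zero] at h
    have : ‖x‖ ^ 2 ≤ 0 := by nlinarith
    simpa using this
  obtain ⟨z, hz⟩ := LinearMap.injective_iff_surjective.1 hinj v
  have hz' : U z = v := hz
  have h1 : ‖v‖ ^ 2 ≤ ‖z‖ * ‖adjoint U v‖ := by
    rw [← real_inner_self_eq_norm_sq]
    nth_rewrite 1 [← hz']
    rw [← adjoint_inner_right]
    exact real_inner_le_norm _ _
  have h2 := ha z
  rw [hz'] at h2
  rcases (norm_nonneg v).eq_or_lt with hv | hv
  · rw [← hv]; simp
  have h3 : (‖v‖ ^ 2) ^ 2 ≤ ‖z‖ ^ 2 * ‖adjoint U v‖ ^ 2 := by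
    rw [← mul_pow]; gcongr
  have h4 := mul_le_mul_of_nonneg_right h2 (sq_nonneg ‖adjoint U v‖)
  have h5 := mul_le_mul_of_nonneg_left h3 ha0.le
  refine le_of_mul_le_mul_right (a := ‖v‖ ^ 2) ?_ (by positivity)
  nlinarith

theorem norm_smul_id_sub_comp_adjoint_le {F E : Type*} [NormedAddCommGroup F]
    [InnerProductSpace ℝ F] [CompleteSpace F] [NormedAddCommGroup E] [InnerProductSpace ℝ E]
    [CompleteSpace E] {U : F →L[ℝ] E} {lam : ℝ} (hlam : 0 ≤ lam) (hb : ‖U‖ ^ 2 ≤ 2 * lam) :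
    ‖lam • ContinuousLinearMap.id ℝ E - U ∘L adjoint U‖ ≤ lam := by
  refine opNorm_le_bound _ hlam fun v => le_of_sq_le_sq ?_ (by positivity)
  have h : ‖U (adjoint U v)‖ ^ 2 ≤ 2 * lam * ‖adjoint U v‖ ^ 2 := by
    calc _ ≤ (‖U‖ * ‖adjoint U v‖) ^ 2 := by gcongr; exact U.le_opNorm _
      _ = ‖U‖ ^ 2 * ‖adjoint U v‖ ^ 2 := by ring
      _ ≤ _ := by gcongr
  have hA : inner ℝ v (U (adjoint U v)) = ‖adjoint U v‖ ^ 2 := by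
    rw [← adjoint_inner_left, real_inner_self_eq_norm_sq]
  simp only [_root_.sub_apply, _root_.smul_apply, coe_id', id_eq, ContinuousLinearMap.comp_apply,
    norm_sub_sq_real, real_inner_smul_left, hA, norm_smul, mul_pow, Real.norm_of_nonneg hlam]
  linarith

theorem upper_rate_step {η lam Δ a p : ℝ} (hη : 0 ≤ η) (hΔ : 0 < Δ) (hΔl : Δ ≤ lam)
    (hstep : η * lam ^ 2 ≤ Δ / 36) (hηl : η * lam ≤ 1 / 36) (hp : 0 ≤ p)
    (hpb : p ^ 2 ≤ lam - Δ / 2) (ha : 0 ≤ a) (hal : a ≤ 2 * lam) :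
    0 ≤ p * (1 + η * (lam - Δ) - η * (1 - η * lam) * (p ^ 2 + a)) ∧
      (p * (1 + η * (lam - Δ) - η * (1 - η * lam) * (p ^ 2 + a))) ^ 2 ≤ lam - Δ / 2 := by
  obtain ⟨c, hc⟩ : ∃ c, c = η * (1 - η * lam) := ⟨_, rfl⟩
  have hηl0 : 0 ≤ η * lam := by nlinarith
  have hc0 : 0 ≤ c := by rw [hc]; exact mul_nonneg hη (by linarith)
  have hcη : c ≤ η := by rw [hc]; nlinarith
  obtain ⟨β, hβ0, hβ⟩ : ∃ β : ℝ, 0 ≤ β ∧ β ^ 2 = lam - Δ / 2 :=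
    ⟨√(lam - Δ / 2), Real.sqrt_nonneg _, Real.sq_sqrt (by linarith)⟩
  have hpβ : p ≤ β := le_of_sq_le_sq (by rw [hβ]; exact hpb) hβ0
  have hcl : c * lam ≤ 1 / 36 := by nlinarith
  have hηΔ : 0 ≤ η * (lam - Δ) := mul_nonneg hη (by linarith)
  rw [← hc, ← hβ]
  have h0 : 0 ≤ p * (1 + η * (lam - Δ) - c * (p ^ 2 + a)) := by
    apply mul_nonneg hp
    nlinarith
  refine ⟨h0, ?_⟩
  gcongr
  have h1 : p * (1 + η * (lam - Δ) - c * (p ^ 2 + a)) ≤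
      p * (1 + η * (lam - Δ) - c * p ^ 2) := by
    gcongr
    linarith
  have h2 : 0 ≤ (β - p) * (1 + η * (lam - Δ) - c * (β ^ 2 + β * p + p ^ 2)) := by
    apply mul_nonneg (by linarith)
    have h3 : β * p ≤ β ^ 2 := by nlinarith
    nlinarith
  have h3 : β * (η * (lam - Δ)) ≤ β * (c * β ^ 2) := by
    refine mul_le_mul_of_nonneg_left ?_ hβ0
    rw [hβ, hc]
    nlinarith [mul_nonneg hη hηl0]
  nlinarith

theorem lower_rate_step {η lam Δ a p : ℝ} (hη : 0 ≤ η) (hΔ : 0 < Δ) (hΔl : Δ ≤ lam)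
    (hηl : η * lam ≤ 1 / 36) (hpb : p ^ 2 ≤ lam - Δ / 2) (ha : 0 < a) (hal : a ≤ 2 * lam) :
    0 < a * (1 + 2 * η * (lam - p ^ 2 - a)) ∧ a * (1 + 2 * η * (lam - p ^ 2 - a)) ≤ 2 * lam ∧
      min (Δ / 4) (a * (1 + η * Δ / 2)) ≤ a * (1 + 2 * η * (lam - p ^ 2 - a)) := by
  have hηΔ : η * Δ ≤ 1 / 36 := (mul_le_mul_of_nonneg_left hΔl hη).trans hηl
  have hηΔ0 : 0 ≤ η * Δ := by positivity
  have hηl0 : 0 ≤ η * lam := by nlinarith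
  refine ⟨mul_pos ha (by nlinarith), ?_, ?_⟩
  · have : a * (1 + 2 * η * (lam - p ^ 2 - a)) ≤ a * (1 + 2 * η * (lam - a)) := by
      have := sq_nonneg p
      gcongr
      linarith
    have h2 : 0 ≤ (2 * lam - a) * (1 - 2 * η * (lam + a)) := by
      apply mul_nonneg (by linarith)
      nlinarith
    nlinarith
  · have h1 : a * (1 + 2 * η * (Δ / 2 - a)) ≤ a * (1 + 2 * η * (lam - p ^ 2 - a)) := by
      gcongr
      linarith
    rcases le_total a (Δ / 4) with h | h
    · refine (min_le_right _ _).trans (le_trans ?_ h1)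
      gcongr
      nlinarith
    · refine (min_le_left _ _).trans (le_trans ?_ h1)
      have h2 : 0 ≤ (a - Δ / 4) * (1 + η * Δ - 2 * η * (a + Δ / 4)) := by
        apply mul_nonneg (by linarith)
        nlinarith
      nlinarith

theorem ratio_step {η lam Δ a p : ℝ} (hη : 0 ≤ η) (hΔ : 0 < Δ) (hΔl : Δ ≤ lam)
    (hstep : η * lam ^ 2 ≤ Δ / 36) (hηl : η * lam ≤ 1 / 36)
    (hpb : p ^ 2 ≤ lam - Δ / 2) (ha : 0 ≤ a) (hal : a ≤ 2 * lam) :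
    (1 + η * (lam - Δ) - η * (1 - η * lam) * (p ^ 2 + a)) ^ 2 ≤
      (1 - η * Δ / 2) * (1 + 2 * η * (lam - p ^ 2 - a)) := by
  obtain ⟨s, hs⟩ : ∃ s, s = p ^ 2 + a := ⟨_, rfl⟩
  have hs0 : 0 ≤ s := by rw [hs]; positivity
  have hs3 : s ≤ 3 * lam := by linarith
  have hηl0 : 0 ≤ η * lam := by nlinarith
  obtain ⟨z, hz⟩ : ∃ z, z = lam - Δ - s + η * lam * s := ⟨_, rfl⟩
  have hz2 : z ^ 2 ≤ 9 * lam ^ 2 := by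
    have : z ^ 2 ≤ (3 * lam) ^ 2 := by
      apply sq_le_sq' <;> rw [hz] <;> nlinarith [mul_nonneg hηl0 hs0]
    linarith
  have e1 : 1 + η * (lam - Δ) - η * (1 - η * lam) * (p ^ 2 + a) = 1 + η * z := by
    rw [hz, ← hs]; ring
  have e2 : lam - p ^ 2 - a = lam - s := by rw [hs]; ring
  rw [e1, e2]
  have h1 : η ^ 2 * z ^ 2 ≤ η * Δ / 4 := by
    calc η ^ 2 * z ^ 2 ≤ η ^ 2 * (9 * lam ^ 2) := by gcongr
      _ = 9 * η * (η * lam ^ 2) := by ring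
      _ ≤ 9 * η * (Δ / 36) := by gcongr
      _ = _ := by ring
  have h2 : η * (η * lam * s) ≤ η * Δ / 12 := by
    calc η * (η * lam * s) ≤ η * (η * lam * (3 * lam)) := by gcongr
      _ = 3 * η * (η * lam ^ 2) := by ring
      _ ≤ 3 * η * (Δ / 36) := by gcongr
      _ = _ := by ring
  have h3 : η * Δ / 2 * (2 * η * (lam - s)) ≤ η * Δ / 2 * (1 / 18) := by
    gcongr
    nlinarith
  have h4 : η * z = η * (lam - s) - η * Δ + η * (η * lam * s) := by rw [hz]; ring
  have h5 : (1 + η * z) ^ 2 = 1 + 2 * (η * z) + η ^ 2 * z ^ 2 := by ring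
  rw [h5, h4]
  have : 0 ≤ η * Δ := by positivity
  nlinarith

section Trajectory

variable {F E : Type*} [NormedAddCommGroup F] [InnerProductSpace ℝ F] [CompleteSpace F]
  [NormedAddCommGroup E] [InnerProductSpace ℝ E] [CompleteSpace E]

theorem norm_sq_gram_apply_le {U : F →L[ℝ] F} {J : F →L[ℝ] E} {b : ℝ} (hb : 0 ≤ b)
    (h : ∀ x, ‖U x‖ ^ 2 + ‖J x‖ ^ 2 ≤ b * ‖x‖ ^ 2) (x : F) :
    ‖(adjoint U ∘L U + adjoint J ∘L J) x‖ ^ 2 ≤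
      b * inner ℝ ((adjoint U ∘L U + adjoint J ∘L J) x) x := by
  refine norm_sq_apply_le hb (fun x y => ?_) (fun x => ?_) (fun x => ?_) x
  · simp [inner_add_left, inner_add_right, adjoint_inner_left, adjoint_inner_right]
  · simp only [_root_.add_apply, ContinuousLinearMap.comp_apply, inner_add_left, adjoint_inner_left,
      real_inner_self_eq_norm_sq]
    positivity
  · simpa only [_root_.add_apply, ContinuousLinearMap.comp_apply, inner_add_left,
      adjoint_inner_left, real_inner_self_eq_norm_sq] using h x

theorem isSelfAdjoint_gram (U : F →L[ℝ] F) (J : F →L[ℝ] E) :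
    IsSelfAdjoint (adjoint U ∘L U + adjoint J ∘L J) := by
  rw [ContinuousLinearMap.isSelfAdjoint_iff']
  simp [adjoint_comp]

variable [FiniteDimensional ℝ F]

theorem blocks_step {U : F →L[ℝ] F} {J : F →L[ℝ] E} {L : E →L[ℝ] E} {η lam Δ a p : ℝ}
    (hη : 0 ≤ η) (hΔ : 0 < Δ) (hΔl : Δ ≤ lam)
    (hηl : η * lam ≤ 1 / 36) (hL : ‖L‖ ≤ lam - Δ)
    (hp : 0 ≤ p) (hpb : p ^ 2 ≤ lam - Δ / 2) (ha : 0 < a) (hal : a ≤ 2 * lam)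
    (h : ∀ x, ‖U x‖ ^ 2 + ‖J x‖ ^ 2 ≤ 2 * lam * ‖x‖ ^ 2)
    (hU : ∀ v, a * ‖v‖ ^ 2 ≤ ‖adjoint U v‖ ^ 2) (hJ : ‖J‖ ≤ p) :
    (∀ v, a * (1 + 2 * η * (lam - p ^ 2 - a)) * ‖v‖ ^ 2 ≤
      ‖adjoint ((1 + η * lam) • U - η • U ∘L (adjoint U ∘L U + adjoint J ∘L J)) v‖ ^ 2) ∧
    ‖J - η • J ∘L (adjoint U ∘L U + adjoint J ∘L J) + η • L ∘L J‖ ≤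
      p * (1 + η * (lam - Δ) - η * (1 - η * lam) * (p ^ 2 + a)) := by
  have hlam : 0 ≤ lam := by linarith
  have hG : ∀ x, inner ℝ ((adjoint U ∘L U + adjoint J ∘L J) x) x = ‖U x‖ ^ 2 + ‖J x‖ ^ 2 :=
    fun x => by
      simp only [_root_.add_apply, ContinuousLinearMap.comp_apply, inner_add_left,
        adjoint_inner_left, real_inner_self_eq_norm_sq]
  have hU' : ∀ x, a * ‖x‖ ^ 2 ≤ ‖U x‖ ^ 2 := fun x => by
    simpa using le_norm_sq_adjoint_of_le_norm_sq ha hU x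
  have hUn : ‖U‖ ≤ √(2 * lam) := by
    refine opNorm_le_bound _ (Real.sqrt_nonneg _) fun x => le_of_sq_le_sq ?_ (by positivity)
    rw [mul_pow, Real.sq_sqrt (by positivity)]
    linarith [h x, sq_nonneg ‖J x‖]
  have hUadj : ∀ v, ‖adjoint U v‖ ^ 2 ≤ 2 * lam * ‖v‖ ^ 2 := fun v => by
    have := (adjoint U).le_of_opNorm_le ((adjoint.norm_map U).trans_le hUn) v
    calc _ ≤ (√(2 * lam) * ‖v‖) ^ 2 := by gcongr
      _ = _ := by rw [mul_pow, Real.sq_sqrt (by positivity)]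
  constructor
  · refine le_norm_sq_adjoint_step hη hal (isSelfAdjoint_gram U J) hU hUadj (fun x => ?_) ?_
    · rw [hG, ← mul_pow]
      gcongr
      exact J.le_of_opNorm_le hJ x
    · nlinarith
  · refine norm_factored_step_le hη hlam (by linarith) hp ha.le (isSelfAdjoint_gram U J)
      (norm_sq_gram_apply_le (by positivity) h) (fun x => ?_) hJ hL ?_
    · rw [hG]
      linarith [hU' x]
    · nlinarith

/-- Bounds propagated along the trajectory: `a` bounds the squared smallest singular value of the
top block from below and `p` bounds the norm of the bottom block. -/
structure BlockBounds (lam Δ : ℝ) (U : F →L[ℝ] F) (J : F →L[ℝ] E) (a p : ℝ) : Prop where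
  p_nonneg : 0 ≤ p
  p_sq_le : p ^ 2 ≤ lam - Δ / 2
  a_pos : 0 < a
  a_le : a ≤ 2 * lam
  le_top : ∀ v, a * ‖v‖ ^ 2 ≤ ‖adjoint U v‖ ^ 2
  bot_le : ‖J‖ ≤ p

variable {U : ℕ → F →L[ℝ] F} {J : ℕ → F →L[ℝ] E} {L : E →L[ℝ] E} {η lam Δ : ℝ}

theorem exists_blockBounds_step (hη : 0 ≤ η) (hΔ : 0 < Δ) (hΔl : Δ ≤ lam)
    (hstep : η * lam ^ 2 ≤ Δ / 36) (hηl : η * lam ≤ 1 / 36) (hL : ‖L‖ ≤ lam - Δ)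
    (hU : ∀ t, U (t + 1) = (1 + η * lam) • U t -
      η • U t ∘L (adjoint (U t) ∘L U t + adjoint (J t) ∘L J t))
    (hJ : ∀ t, J (t + 1) = J t - η • J t ∘L (adjoint (U t) ∘L U t + adjoint (J t) ∘L J t) +
      η • L ∘L J t)
    (h : ∀ t x, ‖U t x‖ ^ 2 + ‖J t x‖ ^ 2 ≤ 2 * lam * ‖x‖ ^ 2) {t : ℕ} {a p : ℝ}
    (hb : BlockBounds lam Δ (U t) (J t) a p) :
    ∃ a' p', BlockBounds lam Δ (U (t + 1)) (J (t + 1)) a' p' ∧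
      min (Δ / 4) (a * (1 + η * Δ / 2)) ≤ a' ∧ p' ^ 2 * a ≤ (1 - η * Δ / 2) * (p ^ 2 * a') := by
  obtain ⟨hp, hpb, ha, hal, hlt, hbl⟩ := hb
  have h1 := blocks_step hη hΔ hΔl hηl hL hp hpb ha hal (h t) hlt hbl
  have h2 := upper_rate_step hη hΔ hΔl hstep hηl hp hpb ha.le hal
  have h3 := lower_rate_step hη hΔ hΔl hηl hpb ha hal
  have h4 := ratio_step hη hΔ hΔl hstep hηl hpb ha.le hal
  refine ⟨_, _, ⟨h2.1, h2.2, h3.1, h3.2.1, ?_, ?_⟩, h3.2.2, ?_⟩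
  · rw [hU]; exact h1.1
  · rw [hJ]; exact h1.2
  · have := mul_le_mul_of_nonneg_left h4 (mul_nonneg (sq_nonneg p) ha.le)
    linarith

theorem exists_blockBounds (hη : 0 ≤ η) (hΔ : 0 < Δ) (hΔl : Δ ≤ lam)
    (hstep : η * lam ^ 2 ≤ Δ / 36) (hηl : η * lam ≤ 1 / 36) (hL : ‖L‖ ≤ lam - Δ)
    (hU : ∀ t, U (t + 1) = (1 + η * lam) • U t -
      η • U t ∘L (adjoint (U t) ∘L U t + adjoint (J t) ∘L J t))
    (hJ : ∀ t, J (t + 1) = J t - η • J t ∘L (adjoint (U t) ∘L U t + adjoint (J t) ∘L J t) +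
      η • L ∘L J t)
    (h : ∀ t x, ‖U t x‖ ^ 2 + ‖J t x‖ ^ 2 ≤ 2 * lam * ‖x‖ ^ 2) {a p : ℝ}
    (hb : BlockBounds lam Δ (U 0) (J 0) a p) (t : ℕ) :
    ∃ a' p', BlockBounds lam Δ (U t) (J t) a' p' ∧
      min (Δ / 4) (a * (1 + η * Δ / 2) ^ t) ≤ a' := by
  induction t with
  | zero => exact ⟨a, p, hb, by simp⟩
  | succ t ih =>
    obtain ⟨a', p', hb', ha'⟩ := ih
    obtain ⟨a'', p'', hb'', ha'', -⟩ :=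
      exists_blockBounds_step hη hΔ hΔl hstep hηl hL hU hJ h hb'
    refine ⟨a'', p'', hb'', le_trans (le_min (min_le_left _ _) ?_) ha''⟩
    have h1 : 0 ≤ η * Δ / 2 := by positivity
    rcases min_le_iff.1 ha' with h2 | h2
    · exact (min_le_left _ _).trans (by nlinarith)
    · refine (min_le_right _ _).trans ?_
      rw [pow_succ, ← mul_assoc]
      gcongr

theorem residual_bounds_of_le (hη : 0 ≤ η) (hΔ : 0 < Δ) (hΔl : Δ ≤ lam)
    (hstep : η * lam ^ 2 ≤ Δ / 36) (hηl : η * lam ≤ 1 / 36) (hL : ‖L‖ ≤ lam - Δ)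
    (hU : ∀ t, U (t + 1) = (1 + η * lam) • U t -
      η • U t ∘L (adjoint (U t) ∘L U t + adjoint (J t) ∘L J t))
    (hJ : ∀ t, J (t + 1) = J t - η • J t ∘L (adjoint (U t) ∘L U t + adjoint (J t) ∘L J t) +
      η • L ∘L J t)
    (h : ∀ t x, ‖U t x‖ ^ 2 + ‖J t x‖ ^ 2 ≤ 2 * lam * ‖x‖ ^ 2) {a p : ℝ} {T : ℕ}
    (hb : BlockBounds lam Δ (U T) (J T) a p) (haT : Δ / 4 ≤ a) (s : ℕ) :
    ∃ a' p', BlockBounds lam Δ (U (T + s)) (J (T + s)) a' p' ∧ Δ / 4 ≤ a' ∧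
      Δ * p' ^ 2 ≤ 4 * lam * (1 - η * Δ / 2) ^ s * a' ∧
      Δ ^ 2 * ‖lam • ContinuousLinearMap.id ℝ F - U (T + s) ∘L adjoint (U (T + s))‖ +
        160 * lam ^ 3 * (1 - η * Δ / 2) ^ s ≤ 161 * lam ^ 3 * (1 - η * Δ / 4) ^ s := by
  have hlam : 0 ≤ lam := by linarith
  have hηΔ0 : 0 ≤ η * Δ := by positivity
  have hηΔ : η * Δ ≤ 1 / 36 := (mul_le_mul_of_nonneg_left hΔl hη).trans hηl
  have hUn : ∀ t, ‖U t‖ ^ 2 ≤ 2 * lam := fun t => by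
    have : ‖U t‖ ≤ √(2 * lam) := by
      refine opNorm_le_bound _ (Real.sqrt_nonneg _) fun x => le_of_sq_le_sq ?_ (by positivity)
      rw [mul_pow, Real.sq_sqrt (by positivity)]
      linarith [h t x, sq_nonneg ‖J t x‖]
    calc _ ≤ √(2 * lam) ^ 2 := by gcongr
      _ = _ := Real.sq_sqrt (by positivity)
  induction s with
  | zero =>
    refine ⟨a, p, hb, haT, ?_, ?_⟩
    · have := hb.p_sq_le
      nlinarith
    · have h1 := norm_smul_id_sub_comp_adjoint_le hlam (hUn T)
      have h2 : Δ ^ 2 * ‖lam • ContinuousLinearMap.id ℝ F - U T ∘L adjoint (U T)‖ ≤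
          lam ^ 2 * lam := by gcongr
      simp only [add_zero, pow_zero, mul_one]
      linarith
  | succ s ih =>
    obtain ⟨a', p', hb', ha', hratio, hV⟩ := ih
    obtain ⟨a'', p'', hb'', ha'', hr⟩ :=
      exists_blockBounds_step hη hΔ hΔl hstep hηl hL hU hJ h hb'
    have hw : 0 ≤ (1 - η * Δ / 2) ^ s := pow_nonneg (by linarith) s
    refine ⟨a'', p'', hb'', le_trans (le_min le_rfl ?_) ha'', ?_, ?_⟩
    · nlinarith
    · refine le_of_mul_le_mul_right (a := a') ?_ hb'.a_pos
      have h1 := mul_le_mul_of_nonneg_left hr hΔ.le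
      have h2 := mul_le_mul_of_nonneg_right hratio
        (mul_nonneg (show 0 ≤ 1 - η * Δ / 2 by linarith) hb''.a_pos.le)
      rw [pow_succ _ s]
      linarith
    · have hj : ‖J (T + s)‖ ^ 2 ≤ p' ^ 2 := by
        have := hb'.bot_le
        gcongr
      have h1 := norm_residual_step_le (j := p' ^ 2) hη hlam hηl
        (ha'.trans hb'.a_le) (fun v => (mul_le_mul_of_nonneg_right ha' (sq_nonneg ‖v‖)).trans
        (hb'.le_top v)) (hUn (T + s)) hj (hb'.p_sq_le.trans (by linarith))
      rw [← hU] at h1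
      have h2 : Δ * p' ^ 2 ≤ 8 * lam ^ 2 * (1 - η * Δ / 2) ^ s := by
        have := mul_le_mul_of_nonneg_left hb'.a_le
          (show 0 ≤ 4 * lam * (1 - η * Δ / 2) ^ s by positivity)
        linarith
      have h3 := mul_le_mul_of_nonneg_left h1 (sq_nonneg Δ)
      have h4 := mul_le_mul_of_nonneg_left h2 (show 0 ≤ 5 * η * lam * Δ by positivity)
      have h5 := mul_le_mul_of_nonneg_left hV (show 0 ≤ 1 - η * Δ / 4 by linarith)
      rw [pow_succ _ s, pow_succ _ s, ← add_assoc T s 1]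
      linarith

end Trajectory

/-- The continuous linear map between Euclidean spaces given by a real matrix. -/
noncomputable def euclideanMap {m n : ℕ} :
    Matrix (Fin m) (Fin n) ℝ ≃ₗ[ℝ] (EuclideanSpace ℝ (Fin n) →L[ℝ] EuclideanSpace ℝ (Fin m)) :=
  Matrix.toEuclideanLin.trans LinearMap.toContinuousLinearMap

section EuclideanMap

variable {l m n : ℕ}

theorem euclideanMap_apply (M : Matrix (Fin m) (Fin n) ℝ) (v : EuclideanSpace ℝ (Fin n)) :
    euclideanMap M v = WithLp.toLp 2 (M *ᵥ v.ofLp) := rfl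

theorem euclideanMap_mul (A : Matrix (Fin l) (Fin m) ℝ) (B : Matrix (Fin m) (Fin n) ℝ) :
    euclideanMap (A * B) = euclideanMap A ∘L euclideanMap B := by
  ext v
  simp [euclideanMap_apply]

theorem euclideanMap_transpose (A : Matrix (Fin m) (Fin n) ℝ) :
    euclideanMap Aᵀ = adjoint (euclideanMap A) := by
  refine (ContinuousLinearMap.eq_adjoint_iff _ _).2 fun x y => ?_
  simp only [euclideanMap_apply, EuclideanSpace.inner_eq_star_dotProduct, star_trivial]
  rw [Matrix.mulVec_transpose, dotProduct_comm, ← Matrix.dotProduct_mulVec, dotProduct_comm]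

theorem euclideanMap_one :
    euclideanMap (1 : Matrix (Fin n) (Fin n) ℝ) = ContinuousLinearMap.id ℝ _ := by
  ext v
  simp [euclideanMap_apply]

theorem euclideanMap_single (M : Matrix (Fin m) (Fin n) ℝ) (j : Fin n) (i : Fin m) :
    euclideanMap M (EuclideanSpace.single j 1) i = M i j := by
  simp [euclideanMap_apply]

theorem sum_sq_mul_le (A : Matrix (Fin l) (Fin m) ℝ) (B : Matrix (Fin m) (Fin n) ℝ) :
    ∑ i, ∑ j, (A * B) i j ^ 2 ≤ ‖euclideanMap A‖ ^ 2 * ∑ i, ∑ j, B i j ^ 2 := by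
  rw [Finset.sum_comm, Finset.sum_comm (f := fun i j => B i j ^ 2), Finset.mul_sum]
  refine Finset.sum_le_sum fun j _ => ?_
  have h := (euclideanMap A).le_opNorm (euclideanMap B (EuclideanSpace.single j 1))
  rw [← ContinuousLinearMap.comp_apply, ← euclideanMap_mul] at h
  have h2 : ‖euclideanMap (A * B) (EuclideanSpace.single j 1)‖ ^ 2 ≤
      (‖euclideanMap A‖ * ‖euclideanMap B (EuclideanSpace.single j 1)‖) ^ 2 := by gcongr
  simpa only [mul_pow, EuclideanSpace.real_norm_sq_eq, euclideanMap_single] using h2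

theorem sum_sq_le (A : Matrix (Fin m) (Fin n) ℝ) :
    ∑ i, ∑ j, A i j ^ 2 ≤ n * ‖euclideanMap A‖ ^ 2 := by
  have h := sum_sq_mul_le A (1 : Matrix (Fin n) (Fin n) ℝ)
  simpa [Matrix.one_apply, mul_comm] using h

theorem sum_sq_transpose (A : Matrix (Fin m) (Fin n) ℝ) :
    ∑ i, ∑ j, Aᵀ i j ^ 2 = ∑ i, ∑ j, A i j ^ 2 := by
  rw [Finset.sum_comm]
  rfl

theorem sigmaMax_nonneg (M : Matrix (Fin m) (Fin n) ℝ) : 0 ≤ sigmaMax M := by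
  refine Real.sSup_nonneg ?_
  rintro _ ⟨v, -, rfl⟩
  exact norm_nonneg _

theorem norm_euclideanMap_le_sigmaMax (M : Matrix (Fin m) (Fin n) ℝ) :
    ‖euclideanMap M‖ ≤ sigmaMax M := by
  refine opNorm_le_of_unit_norm (sigmaMax_nonneg M) fun v hv => ?_
  refine le_csSup ⟨‖euclideanMap M‖, ?_⟩ ⟨v, hv, rfl⟩
  rintro _ ⟨w, hw, rfl⟩
  have h := (euclideanMap M).le_opNorm w
  rw [hw, mul_one] at h
  exact h

theorem sigmaMin_mul_norm_le (M : Matrix (Fin m) (Fin n) ℝ) (v : EuclideanSpace ℝ (Fin n)) :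
    sigmaMin M * ‖v‖ ≤ ‖euclideanMap M v‖ := by
  rcases eq_or_ne v 0 with rfl | hv
  · simp
  have hv' : 0 < ‖v‖ := norm_pos_iff.2 hv
  have h : sigmaMin M ≤ ‖euclideanMap M (‖v‖⁻¹ • v)‖ := by
    refine csInf_le ⟨0, ?_⟩ ⟨‖v‖⁻¹ • v, ?_, rfl⟩
    · rintro _ ⟨w, -, rfl⟩
      exact norm_nonneg _
    · rw [norm_smul, norm_inv, norm_norm, inv_mul_cancel₀ hv'.ne']
  rw [map_smul, norm_smul, norm_inv, norm_norm, inv_mul_eq_div, le_div_iff₀ hv'] at h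
  exact h

theorem norm_euclideanMap_diagonal_le (w : Fin n → ℝ) {c : ℝ} (hc : 0 ≤ c) (hw : ∀ i, |w i| ≤ c) :
    ‖euclideanMap (Matrix.diagonal w)‖ ≤ c := by
  refine opNorm_le_bound _ hc fun v => le_of_sq_le_sq ?_ (by positivity)
  rw [mul_pow, EuclideanSpace.real_norm_sq_eq, EuclideanSpace.real_norm_sq_eq, Finset.mul_sum]
  refine Finset.sum_le_sum fun i _ => ?_
  simp only [euclideanMap_apply, Matrix.mulVec_diagonal, mul_pow]
  exact mul_le_mul_of_nonneg_right (sq_le_sq' (abs_le.1 (hw i)).1 (abs_le.1 (hw i)).2)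
    (sq_nonneg _)

end EuclideanMap

section Blocks

variable {d r : ℕ}

theorem sum_fin_eq_sum_blocks (h : r ≤ d) (f : Fin d → ℝ) :
    ∑ i, f i = ∑ i : Fin r, f (Fin.castLE h i) +
      ∑ i : Fin (d - r), f ⟨r + (i : ℕ), by have := i.isLt; omega⟩ := by
  rw [← (finCongr (Nat.add_sub_of_le h)).sum_comp, Fin.sum_univ_add]
  rfl

theorem transpose_mul_self_eq_blocks (h : r ≤ d) (X : Matrix (Fin d) (Fin r) ℝ) :
    Xᵀ * X = (topBlock h X)ᵀ * topBlock h X + (botBlock X)ᵀ * botBlock X := by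
  ext i j
  simp only [Matrix.mul_apply, Matrix.add_apply, Matrix.transpose_apply]
  exact sum_fin_eq_sum_blocks h _

theorem topBlock_mul (h : r ≤ d) (X : Matrix (Fin d) (Fin r) ℝ) (B : Matrix (Fin r) (Fin r) ℝ) :
    topBlock h (X * B) = topBlock h X * B := rfl

theorem botBlock_mul (X : Matrix (Fin d) (Fin r) ℝ) (B : Matrix (Fin r) (Fin r) ℝ) :
    botBlock (X * B) = botBlock X * B := rfl

theorem topBlock_step (h : r ≤ d) {lam : Fin d → ℝ} {c : ℝ}
    (hc : ∀ i : Fin d, (i : ℕ) < r → lam i = c) (η : ℝ) (X : Matrix (Fin d) (Fin r) ℝ) :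
    topBlock h (X + η • ((Matrix.diagonal lam - X * Xᵀ) * X)) =
      (1 + η * c) • topBlock h X - η • (topBlock h X *
        ((topBlock h X)ᵀ * topBlock h X + (botBlock X)ᵀ * botBlock X)) := by
  rw [← transpose_mul_self_eq_blocks h, ← topBlock_mul, ← Matrix.mul_assoc, Matrix.sub_mul]
  ext i j
  simp only [topBlock, Matrix.add_apply, Matrix.smul_apply, Matrix.sub_apply,
    Matrix.diagonal_mul, smul_eq_mul, hc (Fin.castLE h i) i.isLt]
  ring

theorem botBlock_step (h : r ≤ d) (lam : Fin d → ℝ) (η : ℝ) (X : Matrix (Fin d) (Fin r) ℝ) :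
    botBlock (X + η • ((Matrix.diagonal lam - X * Xᵀ) * X)) =
      botBlock X - η • (botBlock X *
        ((topBlock h X)ᵀ * topBlock h X + (botBlock X)ᵀ * botBlock X)) +
      η • (Matrix.diagonal (fun i : Fin (d - r) =>
        lam ⟨r + (i : ℕ), by have := i.isLt; omega⟩) * botBlock X) := by
  rw [← transpose_mul_self_eq_blocks h, ← botBlock_mul, ← Matrix.mul_assoc, Matrix.sub_mul]
  ext i j
  simp only [botBlock, Matrix.add_apply, Matrix.smul_apply, Matrix.sub_apply,
    Matrix.diagonal_mul, smul_eq_mul]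
  ring

theorem norm_sq_eq_blocks (h : r ≤ d) (X : Matrix (Fin d) (Fin r) ℝ)
    (x : EuclideanSpace ℝ (Fin r)) :
    ‖euclideanMap X x‖ ^ 2 =
      ‖euclideanMap (topBlock h X) x‖ ^ 2 + ‖euclideanMap (botBlock X) x‖ ^ 2 := by
  simp only [EuclideanSpace.real_norm_sq_eq]
  exact sum_fin_eq_sum_blocks h _

theorem sum_sq_residual_eq_blocks (h : r ≤ d) {lam : Fin d → ℝ} {c : ℝ}
    (hc : ∀ i : Fin d, (i : ℕ) < r → lam i = c) (X : Matrix (Fin d) (Fin r) ℝ) :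
    ∑ i, ∑ j, (Matrix.diagonal (fun i : Fin d => if (i : ℕ) < r then lam i else 0) -
        X * Xᵀ) i j ^ 2 =
      ∑ i, ∑ j, (c • (1 : Matrix (Fin r) (Fin r) ℝ) - topBlock h X * (topBlock h X)ᵀ) i j ^ 2 +
      2 * ∑ i, ∑ j, (botBlock X * (topBlock h X)ᵀ) i j ^ 2 +
      ∑ i, ∑ j, (botBlock X * (botBlock X)ᵀ) i j ^ 2 := by
  have h1 : ∀ i j : Fin r, (Matrix.diagonal (fun i : Fin d => if (i : ℕ) < r then lam i else 0) -
        X * Xᵀ) (Fin.castLE h i) (Fin.castLE h j) =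
      (c • (1 : Matrix (Fin r) (Fin r) ℝ) - topBlock h X * (topBlock h X)ᵀ) i j := fun i j => by
    have : (X * Xᵀ) (Fin.castLE h i) (Fin.castLE h j) = (topBlock h X * (topBlock h X)ᵀ) i j := rfl
    rw [Matrix.sub_apply, Matrix.sub_apply, this]
    by_cases hij : i = j
    · simp [hij, hc]
    · simp [hij]
  have h2 : ∀ (i : Fin (d - r)) (j : Fin r),
      (Matrix.diagonal (fun i : Fin d => if (i : ℕ) < r then lam i else 0) - X * Xᵀ)
        ⟨r + (i : ℕ), by have := i.isLt; omega⟩ (Fin.castLE h j) =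
      -(botBlock X * (topBlock h X)ᵀ) i j := fun i j => by
    have hne : (⟨r + (i : ℕ), by have := i.isLt; omega⟩ : Fin d) ≠ Fin.castLE h j := fun hh => by
      have hv : r + (i : ℕ) = j := congrArg Fin.val hh
      have := j.isLt
      omega
    rw [Matrix.sub_apply, Matrix.diagonal_apply_ne _ hne, zero_sub]
    rfl
  have h3 : ∀ (i : Fin (d - r)) (j : Fin r),
      (Matrix.diagonal (fun i : Fin d => if (i : ℕ) < r then lam i else 0) - X * Xᵀ)
        (Fin.castLE h j) ⟨r + (i : ℕ), by have := i.isLt; omega⟩ =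
      -(botBlock X * (topBlock h X)ᵀ) i j := fun i j => by
    have hne : Fin.castLE h j ≠ (⟨r + (i : ℕ), by have := i.isLt; omega⟩ : Fin d) := fun hh => by
      have hv : (j : ℕ) = r + i := congrArg Fin.val hh
      have := j.isLt
      omega
    rw [Matrix.sub_apply, Matrix.diagonal_apply_ne _ hne, zero_sub, neg_inj, Matrix.mul_apply,
      Matrix.mul_apply]
    exact Finset.sum_congr rfl fun _ _ => mul_comm _ _
  have h4 : ∀ i j : Fin (d - r),
      (Matrix.diagonal (fun i : Fin d => if (i : ℕ) < r then lam i else 0) - X * Xᵀ)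
        ⟨r + (i : ℕ), by have := i.isLt; omega⟩ ⟨r + (j : ℕ), by have := j.isLt; omega⟩ =
      -(botBlock X * (botBlock X)ᵀ) i j := fun i j => by
    rw [Matrix.sub_apply, Matrix.diagonal_apply]
    simp
    rfl
  rw [sum_fin_eq_sum_blocks h]
  simp only [sum_fin_eq_sum_blocks h (fun j => _ ^ 2), h1, h2, h3, h4, neg_sq,
    Finset.sum_add_distrib]
  rw [Finset.sum_comm (f := fun (i : Fin r) (j : Fin (d - r)) =>
    (botBlock X * (topBlock h X)ᵀ) j i ^ 2)]
  ring

theorem sum_sq_residual_le (h : r ≤ d) {lam : Fin d → ℝ} {c : ℝ}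
    (hc : ∀ i : Fin d, (i : ℕ) < r → lam i = c) (X : Matrix (Fin d) (Fin r) ℝ) :
    ∑ i, ∑ j, (Matrix.diagonal (fun i : Fin d => if (i : ℕ) < r then lam i else 0) -
        X * Xᵀ) i j ^ 2 ≤
      r * (‖c • ContinuousLinearMap.id ℝ _ - euclideanMap (topBlock h X) ∘L
          adjoint (euclideanMap (topBlock h X))‖ ^ 2 +
        2 * (‖euclideanMap (topBlock h X)‖ ^ 2 * ‖euclideanMap (botBlock X)‖ ^ 2) +
        ‖euclideanMap (botBlock X)‖ ^ 2 * ‖euclideanMap (botBlock X)‖ ^ 2) := by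
  have h1 := sum_sq_le (c • (1 : Matrix (Fin r) (Fin r) ℝ) - topBlock h X * (topBlock h X)ᵀ)
  have h2 := sum_sq_mul_le (botBlock X) (topBlock h X)ᵀ
  have h3 := sum_sq_mul_le (botBlock X) (botBlock X)ᵀ
  have h4 := mul_le_mul_of_nonneg_left (sum_sq_le (topBlock h X))
    (sq_nonneg ‖euclideanMap (botBlock X)‖)
  have h5 := mul_le_mul_of_nonneg_left (sum_sq_le (botBlock X))
    (sq_nonneg ‖euclideanMap (botBlock X)‖)
  rw [sum_sq_transpose] at h2 h3
  rw [map_sub, map_smul, euclideanMap_one, euclideanMap_mul, euclideanMap_transpose] at h1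
  rw [sum_sq_residual_eq_blocks h hc]
  linarith

end Blocks

theorem norm_gradient_step_le {F E : Type*} [NormedAddCommGroup F] [InnerProductSpace ℝ F]
    [CompleteSpace F] [NormedAddCommGroup E] [InnerProductSpace ℝ E] [CompleteSpace E]
    {Y : F →L[ℝ] E} {L : E →L[ℝ] E} {η c : ℝ} (hη : 0 ≤ η) (hc0 : 0 ≤ c) (hηc : η * c ≤ 1 / 36)
    (hY : ‖Y‖ ≤ √(2 * c)) (hL : ‖L‖ ≤ c) :
    ‖Y - η • Y ∘L (adjoint Y ∘L Y) + η • L ∘L Y‖ ≤ √(2 * c) := by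
  have hsq : √(2 * c) ^ 2 = 2 * c := Real.sq_sqrt (by positivity)
  have hG : ∀ x, inner ℝ ((adjoint Y ∘L Y) x) x = ‖Y x‖ ^ 2 := fun x => by
    rw [ContinuousLinearMap.comp_apply, adjoint_inner_left, real_inner_self_eq_norm_sq]
  refine (norm_factored_step_le (lam := c) (a := 0) hη hc0 (by linarith) (Real.sqrt_nonneg _)
    le_rfl ?_ (fun x => ?_) (fun x => ?_) hY hL ?_).trans ?_
  · rw [isSelfAdjoint_iff', adjoint_comp, adjoint_adjoint]
  · rw [hG, ContinuousLinearMap.comp_apply]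
    calc _ ≤ (‖adjoint Y‖ * ‖Y x‖) ^ 2 := by
          gcongr; exact le_opNorm _ _
      _ ≤ (√(2 * c) * ‖Y x‖) ^ 2 := by
          rw [LinearIsometryEquiv.norm_map]; gcongr
      _ = _ := by rw [mul_pow, hsq]
  · rw [hG]; simp
  · rw [hsq]; linarith
  · rw [hsq]
    refine mul_le_of_le_one_right (Real.sqrt_nonneg _) ?_
    nlinarith [mul_nonneg hη hc0]

section GradientDescent

variable {d r : ℕ} {lam : Fin d → ℝ} {η c Δ : ℝ} {X0 : Matrix (Fin d) (Fin r) ℝ}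

theorem norm_euclideanMap_gdIter_le (hη : 0 ≤ η) (hc0 : 0 ≤ c) (hηc : η * c ≤ 1 / 36)
    (hlam : ∀ i, |lam i| ≤ c) (hX0 : sigmaMax X0 ^ 2 ≤ 2 * c) (t : ℕ) :
    ‖euclideanMap (gdIter (Matrix.diagonal lam) η X0 t)‖ ≤ √(2 * c) := by
  induction t with
  | zero => exact (norm_euclideanMap_le_sigmaMax _).trans (Real.le_sqrt_of_sq_le hX0)
  | succ t ih =>
    set X := gdIter (Matrix.diagonal lam) η X0 t with hX
    have hstep : euclideanMap (gdIter (Matrix.diagonal lam) η X0 (t + 1)) =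
        euclideanMap X - η • euclideanMap X ∘L (adjoint (euclideanMap X) ∘L euclideanMap X) +
          η • euclideanMap (Matrix.diagonal lam) ∘L euclideanMap X := by
      have : gdIter (Matrix.diagonal lam) η X0 (t + 1) =
          X - η • (X * (Xᵀ * X)) + η • (Matrix.diagonal lam * X) := by
        rw [gdIter, ← hX, Matrix.sub_mul, smul_sub, Matrix.mul_assoc]
        abel
      rw [this, map_add, map_sub, map_smul, map_smul, euclideanMap_mul, euclideanMap_mul,
        euclideanMap_mul, euclideanMap_transpose]
    rw [hstep]
    exact norm_gradient_step_le hη hc0 hηc ih (norm_euclideanMap_diagonal_le lam hc0 hlam)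

theorem euclideanMap_topBlock_gdIter_succ (h : r ≤ d) (hc : ∀ i : Fin d, (i : ℕ) < r → lam i = c)
    (t : ℕ) :
    euclideanMap (topBlock h (gdIter (Matrix.diagonal lam) η X0 (t + 1))) =
      (1 + η * c) • euclideanMap (topBlock h (gdIter (Matrix.diagonal lam) η X0 t)) -
      η • euclideanMap (topBlock h (gdIter (Matrix.diagonal lam) η X0 t)) ∘L
        (adjoint (euclideanMap (topBlock h (gdIter (Matrix.diagonal lam) η X0 t))) ∘L
          euclideanMap (topBlock h (gdIter (Matrix.diagonal lam) η X0 t)) +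
        adjoint (euclideanMap (botBlock (gdIter (Matrix.diagonal lam) η X0 t))) ∘L
          euclideanMap (botBlock (gdIter (Matrix.diagonal lam) η X0 t))) := by
  simp only [gdIter, topBlock_step h hc, map_sub, map_add, map_smul, euclideanMap_mul,
    euclideanMap_transpose]

theorem euclideanMap_botBlock_gdIter_succ (h : r ≤ d) (t : ℕ) :
    euclideanMap (botBlock (gdIter (Matrix.diagonal lam) η X0 (t + 1))) =
      euclideanMap (botBlock (gdIter (Matrix.diagonal lam) η X0 t)) -
      η • euclideanMap (botBlock (gdIter (Matrix.diagonal lam) η X0 t)) ∘L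
        (adjoint (euclideanMap (topBlock h (gdIter (Matrix.diagonal lam) η X0 t))) ∘L
          euclideanMap (topBlock h (gdIter (Matrix.diagonal lam) η X0 t)) +
        adjoint (euclideanMap (botBlock (gdIter (Matrix.diagonal lam) η X0 t))) ∘L
          euclideanMap (botBlock (gdIter (Matrix.diagonal lam) η X0 t))) +
      η • euclideanMap (Matrix.diagonal (fun i : Fin (d - r) =>
        lam ⟨r + (i : ℕ), by have := i.isLt; omega⟩)) ∘L
          euclideanMap (botBlock (gdIter (Matrix.diagonal lam) η X0 t)) := by
  simp only [gdIter, botBlock_step h, map_sub, map_add, map_smul, euclideanMap_mul,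
    euclideanMap_transpose]

theorem norm_sq_topBlock_add_norm_sq_botBlock_le (h : r ≤ d) {X : Matrix (Fin d) (Fin r) ℝ}
    (hc0 : 0 ≤ c) (hX : ‖euclideanMap X‖ ≤ √(2 * c)) (x : EuclideanSpace ℝ (Fin r)) :
    ‖euclideanMap (topBlock h X) x‖ ^ 2 + ‖euclideanMap (botBlock X) x‖ ^ 2 ≤
      2 * c * ‖x‖ ^ 2 := by
  rw [← norm_sq_eq_blocks]
  calc _ ≤ (√(2 * c) * ‖x‖) ^ 2 := by gcongr; exact le_of_opNorm_le _ hX x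
    _ = _ := by rw [mul_pow, Real.sq_sqrt (by positivity)]

theorem norm_sq_blocks_le (h : r ≤ d) {X : Matrix (Fin d) (Fin r) ℝ}
    (hc0 : 0 ≤ c) (hX : ‖euclideanMap X‖ ≤ √(2 * c)) :
    ‖euclideanMap (topBlock h X)‖ ^ 2 ≤ 2 * c ∧ ‖euclideanMap (botBlock X)‖ ^ 2 ≤ 2 * c := by
  have hsq : √(2 * c) ^ 2 = 2 * c := Real.sq_sqrt (by positivity)
  have hb := norm_sq_topBlock_add_norm_sq_botBlock_le h hc0 hX
  constructor
  · rw [← hsq]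
    refine pow_le_pow_left₀ (norm_nonneg _) (opNorm_le_bound _ (Real.sqrt_nonneg _) fun x =>
      le_of_sq_le_sq ?_ (by positivity)) 2
    rw [mul_pow, hsq]
    linarith [hb x, sq_nonneg ‖euclideanMap (botBlock X) x‖]
  · rw [← hsq]
    refine pow_le_pow_left₀ (norm_nonneg _) (opNorm_le_bound _ (Real.sqrt_nonneg _) fun x =>
      le_of_sq_le_sq ?_ (by positivity)) 2
    rw [mul_pow, hsq]
    linarith [hb x, sq_nonneg ‖euclideanMap (topBlock h X) x‖]

theorem frobNorm_residual_le (hr : 0 < r) (h : r ≤ d)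
    (hc : ∀ i : Fin d, (i : ℕ) < r → lam i = c) {X : Matrix (Fin d) (Fin r) ℝ} {e j K : ℝ}
    (hc0 : 0 ≤ c) (hX : ‖euclideanMap X‖ ≤ √(2 * c))
    (he : ‖c • ContinuousLinearMap.id ℝ _ - euclideanMap (topBlock h X) ∘L
      adjoint (euclideanMap (topBlock h X))‖ ≤ e)
    (hj : ‖euclideanMap (botBlock X)‖ ^ 2 ≤ j) (hK : 0 ≤ K)
    (heK : e ^ 2 + 4 * c * j + j ^ 2 ≤ K ^ 2) :
    frobNorm (Matrix.diagonal (fun i : Fin d => if (i : ℕ) < r then lam i else 0) - X * Xᵀ) ≤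
      r * K := by
  have hr1 : (1 : ℝ) ≤ r := by exact_mod_cast hr
  refine Real.sqrt_le_iff.2 ⟨by positivity, (sum_sq_residual_le h hc X).trans ?_⟩
  have h1 := (norm_sq_blocks_le h hc0 hX).1
  have hj0 : 0 ≤ j := (sq_nonneg _).trans hj
  calc _ ≤ (r : ℝ) * (e ^ 2 + 2 * (2 * c * j) + j * j) := by gcongr
    _ ≤ r * K ^ 2 := by gcongr; linarith
    _ ≤ r * (r * K ^ 2) := le_mul_of_one_le_left (by positivity) hr1 |>.trans_eq (by ring)
    _ = _ := by ring

theorem frobNorm_residual_le_of_norm_le (hr : 0 < r) (h : r ≤ d)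
    (hc : ∀ i : Fin d, (i : ℕ) < r → lam i = c) {X : Matrix (Fin d) (Fin r) ℝ}
    (hc0 : 0 ≤ c) (hX : ‖euclideanMap X‖ ≤ √(2 * c)) :
    frobNorm (Matrix.diagonal (fun i : Fin d => if (i : ℕ) < r then lam i else 0) - X * Xᵀ) ≤
      r * (4 * c) := by
  have h1 := norm_sq_blocks_le h hc0 hX
  refine frobNorm_residual_le hr h hc hc0 hX (norm_smul_id_sub_comp_adjoint_le hc0 h1.1) h1.2
    (by positivity) ?_
  nlinarith [sq_nonneg c]

theorem blockBounds_initial (hr : 0 < r) (h : r ≤ d) (hc0 : 0 ≤ c)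
    (hX0 : sigmaMax X0 ^ 2 ≤ 2 * c) (hJ0 : sigmaMax (botBlock X0) ^ 2 ≤ c - Δ / 2)
    (hU0 : 0 < sigmaMin (topBlock h X0)) :
    BlockBounds c Δ (euclideanMap (topBlock h X0)) (euclideanMap (botBlock X0))
      (sigmaMin (topBlock h X0) ^ 2) (sigmaMax (botBlock X0)) := by
  have hlow : ∀ x, sigmaMin (topBlock h X0) ^ 2 * ‖x‖ ^ 2 ≤
      ‖euclideanMap (topBlock h X0) x‖ ^ 2 := fun x => by
    rw [← mul_pow]
    exact pow_le_pow_left₀ (by positivity) (sigmaMin_mul_norm_le _ x) 2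
  refine ⟨sigmaMax_nonneg _, hJ0, by positivity, ?_,
    le_norm_sq_adjoint_of_le_norm_sq (by positivity) hlow, norm_euclideanMap_le_sigmaMax _⟩
  have hX : ‖euclideanMap X0‖ ≤ √(2 * c) :=
    (norm_euclideanMap_le_sigmaMax _).trans (Real.le_sqrt_of_sq_le hX0)
  have h1 := norm_sq_topBlock_add_norm_sq_botBlock_le h hc0 hX (EuclideanSpace.single ⟨0, hr⟩ 1)
  have h2 := hlow (EuclideanSpace.single ⟨0, hr⟩ 1)
  have h3 : ‖EuclideanSpace.single (⟨0, hr⟩ : Fin r) (1 : ℝ)‖ = 1 := by simp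
  rw [h3, one_pow, mul_one] at h1 h2
  linarith [sq_nonneg ‖euclideanMap (botBlock X0) (EuclideanSpace.single ⟨0, hr⟩ 1)‖]

theorem residual_scalar_bound {e j w z : ℝ} (hΔ : 0 < Δ) (hΔc : Δ ≤ c) (he : 0 ≤ e) (hj : 0 ≤ j)
    (hw : 0 ≤ w) (hw1 : w ≤ 1) (hzw : z ≤ w ^ 2) (heb : Δ ^ 2 * e ≤ 161 * c ^ 3 * w)
    (hjb : Δ * j ≤ 8 * c ^ 2 * z) :
    e ^ 2 + 4 * c * j + j ^ 2 ≤ (200 * (c ^ 3 / Δ ^ 2) * w) ^ 2 := by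
  have hc : 0 < c := hΔ.trans_le hΔc
  have hjb' : Δ * j ≤ 8 * c ^ 2 * w ^ 2 := hjb.trans (by gcongr)
  have h1 : (Δ ^ 2 * e) ^ 2 ≤ (161 * c ^ 3 * w) ^ 2 := by gcongr
  have h2 : 4 * c * Δ ^ 3 * (Δ * j) ≤ 4 * c * c ^ 3 * (8 * c ^ 2 * w ^ 2) := by gcongr
  have h3 : Δ ^ 2 * (Δ * j) ^ 2 ≤ c ^ 2 * (8 * c ^ 2 * w ^ 2) ^ 2 := by gcongr
  have h4 : c ^ 6 * w ^ 2 * w ^ 2 ≤ c ^ 6 * w ^ 2 * 1 := by gcongr; exact pow_le_one₀ hw hw1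
  have h5 : 0 ≤ c ^ 6 * w ^ 2 := by positivity
  have h6 : (200 * (c ^ 3 / Δ ^ 2) * w) ^ 2 = 40000 * (c ^ 6 * w ^ 2) / Δ ^ 4 := by
    field_simp
    ring
  rw [h6, le_div_iff₀ (by positivity)]
  linarith

theorem frobNorm_residual_gdIter_add_le (hr : 0 < r) (hrd : r ≤ d)
    (hc : ∀ i : Fin d, (i : ℕ) < r → lam i = c) (hlam : ∀ i, |lam i| ≤ c)
    (hlow : ∀ i : Fin d, r ≤ (i : ℕ) → |lam i| ≤ c - Δ) (hη : 0 ≤ η) (hΔ : 0 < Δ) (hΔc : Δ ≤ c)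
    (hstep : η * c ^ 2 ≤ Δ / 36) (hηc : η * c ≤ 1 / 36) (hX0 : sigmaMax X0 ^ 2 ≤ 2 * c)
    (hJ0 : sigmaMax (botBlock X0) ^ 2 ≤ c - Δ / 2) (hU0 : 0 < sigmaMin (topBlock hrd X0))
    {T : ℕ} (hT : Δ / 4 ≤ sigmaMin (topBlock hrd X0) ^ 2 * (1 + η * Δ / 2) ^ T) (s : ℕ) :
    frobNorm (Matrix.diagonal (fun i : Fin d => if (i : ℕ) < r then lam i else 0) -
        gdIter (Matrix.diagonal lam) η X0 (T + s) *
          (gdIter (Matrix.diagonal lam) η X0 (T + s))ᵀ) ≤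
      r * (200 * (c ^ 3 / Δ ^ 2) * (1 - η * Δ / 4) ^ s) := by
  have hc0 : 0 ≤ c := hΔ.le.trans hΔc
  have hX := norm_euclideanMap_gdIter_le hη hc0 hηc hlam hX0
  have hb := fun t => norm_sq_topBlock_add_norm_sq_botBlock_le hrd hc0 (hX t)
  have hL : ‖euclideanMap (Matrix.diagonal (fun i : Fin (d - r) =>
      lam ⟨r + (i : ℕ), by have := i.isLt; omega⟩))‖ ≤ c - Δ :=
    norm_euclideanMap_diagonal_le _ (by linarith) fun i => hlow _ (Nat.le_add_right _ _)
  have hUs := euclideanMap_topBlock_gdIter_succ (η := η) (X0 := X0) hrd hc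
  have hJs := euclideanMap_botBlock_gdIter_succ (lam := lam) (η := η) (X0 := X0) hrd
  obtain ⟨a, p, hbT, ha⟩ := exists_blockBounds
    (U := fun t => euclideanMap (topBlock hrd (gdIter (Matrix.diagonal lam) η X0 t)))
    (J := fun t => euclideanMap (botBlock (gdIter (Matrix.diagonal lam) η X0 t)))
    hη hΔ hΔc hstep hηc hL hUs hJs hb (blockBounds_initial hr hrd hc0 hX0 hJ0 hU0) T
  replace ha := (min_eq_left hT).symm.trans_le ha
  obtain ⟨a', p', hbs, -, hp, he⟩ := residual_bounds_of_le
    (U := fun t => euclideanMap (topBlock hrd (gdIter (Matrix.diagonal lam) η X0 t)))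
    (J := fun t => euclideanMap (botBlock (gdIter (Matrix.diagonal lam) η X0 t)))
    hη hΔ hΔc hstep hηc hL hUs hJs hb hbT ha s
  have hηΔ0 : 0 ≤ η * Δ := by positivity
  have hηΔ : η * Δ ≤ 1 / 36 := (mul_le_mul_of_nonneg_left hΔc hη).trans hηc
  have hz0 : 0 ≤ (1 - η * Δ / 2) ^ s := pow_nonneg (by linarith) s
  have hw0 : 0 ≤ (1 - η * Δ / 4) ^ s := pow_nonneg (by linarith) s
  refine frobNorm_residual_le hr hrd hc hc0 (hX _) le_rfl
    (pow_le_pow_left₀ (norm_nonneg _) hbs.bot_le 2) (by positivity) ?_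
  refine residual_scalar_bound (z := (1 - η * Δ / 2) ^ s) hΔ hΔc (norm_nonneg _) (sq_nonneg _) hw0
    (pow_le_one₀ (by linarith) (by linarith)) ?_ ?_ ?_
  · rw [pow_right_comm]
    exact pow_le_pow_left₀ (by linarith) (by nlinarith) s
  · refine le_trans (le_add_of_nonneg_right (by positivity)) he
  · refine hp.trans ?_
    calc _ ≤ 4 * c * (1 - η * Δ / 2) ^ s * (2 * c) := by gcongr; exact hbs.a_le
      _ = _ := by ring

end GradientDescent

theorem exp_half_le_one_add {x : ℝ} (hx : 0 ≤ x) (hx1 : x ≤ 1) : Real.exp (x / 2) ≤ 1 + x := by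
  have h := Real.one_sub_le_exp_neg (x / 2)
  rw [Real.exp_neg, le_inv_comm₀ (by linarith) (Real.exp_pos _)] at h
  refine h.trans ((inv_le_iff_one_le_mul₀ (by linarith)).2 ?_)
  nlinarith

theorem le_mul_one_add_pow {a b x T : ℝ} {n : ℕ} (hx : 0 < x) (hx1 : x ≤ 1) (ha : 0 < a)
    (hb : 0 < b) (hT : 2 / x * Real.log (b / a) ≤ T) (hn : T ≤ n) : b ≤ a * (1 + x) ^ n := by
  have h1 : Real.log (b / a) ≤ n * (x / 2) := by
    have := mul_le_mul_of_nonneg_right (hT.trans hn) (half_pos hx).le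
    calc Real.log (b / a) = 2 / x * Real.log (b / a) * (x / 2) := by field_simp
      _ ≤ _ := this
  rw [mul_comm, ← div_le_iff₀ ha]
  calc b / a ≤ Real.exp (n * (x / 2)) := (Real.log_le_iff_le_exp (by positivity)).1 h1
    _ = Real.exp (x / 2) ^ n := Real.exp_nat_mul _ _
    _ ≤ (1 + x) ^ n := by gcongr; exact exp_half_le_one_add hx.le hx1

theorem one_sub_pow_le_inv {x Q : ℝ} {n : ℕ} (hx1 : x ≤ 1) (hQ : 0 < Q)
    (hn : Real.log Q ≤ n * x) : (1 - x) ^ n ≤ Q⁻¹ := by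
  calc (1 - x) ^ n ≤ Real.exp (-x) ^ n := by
        gcongr
        exact Real.one_sub_le_exp_neg x
    _ = Real.exp (-(n * x)) := by rw [← Real.exp_nat_mul]; ring_nf
    _ ≤ Real.exp (-Real.log Q) := by gcongr
    _ = Q⁻¹ := by rw [Real.exp_neg, Real.exp_log hQ]

/-- Theorem 4.3 (deterministic core): with equal top eigenvalues and initialization in `R₂`
with `σ_r(U₀) > 0`, gradient descent converges globally at a linear rate. -/
theorem moderate_init_global_convergence :
    ∃ C : ℝ, 0 < C ∧
      ∀ (d r : ℕ), 0 < r → ∀ (hrd : r < d) (lam : Fin d → ℝ),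
        (∀ i j : Fin d, i ≤ j → lam j ≤ lam i) →
        (∀ i, 0 ≤ lam i) →
        (∀ i : Fin d, (i : ℕ) < r → lam i = lam ⟨0, by omega⟩) →
        ∀ η : ℝ, 0 < η →
        0 < lam ⟨r - 1, by omega⟩ - lam ⟨r, hrd⟩ →
        η ≤ (lam ⟨r - 1, by omega⟩ - lam ⟨r, hrd⟩) ^ 2 / (36 * lam ⟨0, by omega⟩ ^ 3) →
        ∀ X0 : Matrix (Fin d) (Fin r) ℝ,
        inR2 (lam ⟨0, by omega⟩) (lam ⟨r - 1, by omega⟩)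
          (lam ⟨r - 1, by omega⟩ - lam ⟨r, hrd⟩) X0 →
        0 < sigmaMin (topBlock hrd.le X0) →
        ∀ ε : ℝ, 0 < ε → ∀ t : ℕ,
          C * (max 1
              ((1 / (η * (lam ⟨r - 1, by omega⟩ - lam ⟨r, hrd⟩))) *
                Real.log ((lam ⟨r - 1, by omega⟩ - lam ⟨r, hrd⟩) /
                  (4 * sigmaMin (topBlock hrd.le X0) ^ 2))) +
              (1 / (η * (lam ⟨r - 1, by omega⟩ - lam ⟨r, hrd⟩))) *
                Real.log (200 * r * lam ⟨0, by omega⟩ ^ 2 /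
                  (η * (lam ⟨r - 1, by omega⟩ - lam ⟨r, hrd⟩) ^ 2 * ε))) ≤ (t : ℝ) →
          frobNorm
            (Matrix.diagonal (fun i : Fin d => if (i : ℕ) < r then lam i else 0) -
              gdIter (Matrix.diagonal lam) η X0 t * (gdIter (Matrix.diagonal lam) η X0 t)ᵀ)
            ≤ ε := by
  refine ⟨5, by norm_num, fun d r hr hrd lam hanti hnonneg htop η hη hΔ hηle X0 hX0 hU0 ε hε t ht =>
    ?_⟩
  have hrr : lam ⟨r - 1, by omega⟩ = lam ⟨0, by omega⟩ := htop _ (by simp; omega)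
  rw [hrr] at hΔ hηle hX0 ht
  obtain ⟨c, hc⟩ : ∃ c, c = lam ⟨0, by omega⟩ := ⟨_, rfl⟩
  obtain ⟨Δ, hΔd⟩ : ∃ Δ, Δ = c - lam ⟨r, hrd⟩ := ⟨_, rfl⟩
  simp only [← hc] at htop hΔ hηle hX0 ht
  rw [← hΔd] at hΔ hηle hX0 ht
  have hΔc : Δ ≤ c := by linarith [hnonneg ⟨r, hrd⟩]
  have hc0 : 0 < c := hΔ.trans_le hΔc
  have hlam : ∀ i, |lam i| ≤ c := fun i => by
    rw [abs_of_nonneg (hnonneg i), hc]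
    exact hanti _ _ (Fin.mk_le_of_le_val (Nat.zero_le _))
  have hlow : ∀ i : Fin d, r ≤ (i : ℕ) → |lam i| ≤ c - Δ := fun i hi => by
    rw [abs_of_nonneg (hnonneg i), hΔd, sub_sub_cancel]
    exact hanti _ _ (Fin.mk_le_of_le_val hi)
  have hη36 : η * (36 * c ^ 3) ≤ Δ ^ 2 := (le_div_iff₀ (by positivity)).1 hηle
  have hstep : η * c ^ 2 ≤ Δ / 36 := by
    refine le_of_mul_le_mul_right ?_ hc0
    nlinarith
  have hηc : η * c ≤ 1 / 36 := by
    refine le_of_mul_le_mul_right ?_ hc0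
    nlinarith
  have hηΔ : η * Δ ≤ 1 / 36 := (mul_le_mul_of_nonneg_left hΔc hη.le).trans hηc
  obtain ⟨Q, hQ⟩ : ∃ Q, Q = 200 * r * c ^ 2 / (η * Δ ^ 2 * ε) := ⟨_, rfl⟩
  rw [← hQ] at ht
  have hr0 : (0 : ℝ) < r := by exact_mod_cast hr
  have hQ0 : 0 < Q := by rw [hQ]; positivity
  have hQε : Q * (η * Δ ^ 2 * ε) = 200 * r * c ^ 2 := by rw [hQ]; field_simp
  rcases lt_or_ge Q 1 with hQ1 | hQ1
  · refine (frobNorm_residual_le_of_norm_le hr hrd.le htop hc0.le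
      (norm_euclideanMap_gdIter_le hη.le hc0.le hηc hlam hX0.1 t)).trans ?_
    have h1 : 200 * r * c ^ 2 ≤ η * Δ ^ 2 * ε :=
      hQε ▸ mul_le_of_le_one_left (by positivity) hQ1.le
    have h2 : η * Δ ^ 2 * ε ≤ c / 36 * ε := by
      gcongr
      nlinarith
    refine le_of_mul_le_mul_right ?_ hc0
    nlinarith [mul_pos hr0 (pow_pos hc0 2)]
  · have hB : 0 ≤ 1 / (η * Δ) * Real.log Q := mul_nonneg (by positivity) (Real.log_nonneg hQ1)
    obtain ⟨A, hA⟩ : ∃ A, A = 1 / (η * Δ) *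
        Real.log (Δ / (4 * sigmaMin (topBlock hrd.le X0) ^ 2)) := ⟨_, rfl⟩
    rw [← hA] at ht
    have hT : (⌈4 * A⌉₊ : ℝ) ≤ 5 * max 1 A := by
      rcases le_total A 0 with hA0 | hA0
      · rw [Nat.ceil_eq_zero.2 (by linarith)]
        push_cast
        positivity
      · linarith [Nat.ceil_lt_add_one (show 0 ≤ 4 * A by positivity), le_max_left 1 A,
          le_max_right 1 A]
    obtain ⟨s, rfl⟩ : ∃ s, t = ⌈4 * A⌉₊ + s :=
      Nat.exists_eq_add_of_le (by exact_mod_cast hT.trans (le_trans (by linarith) ht))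
    have hs : 4 * (1 / (η * Δ) * Real.log Q) ≤ s := by
      push_cast at ht
      linarith
    refine (frobNorm_residual_gdIter_add_le hr hrd.le htop hlam hlow hη.le hΔ hΔc hstep hηc hX0.1
      hX0.2 hU0 ?_ s).trans ?_
    · refine le_mul_one_add_pow (T := 4 * A) (by positivity) (by linarith) (by positivity)
        (by positivity) (le_of_eq ?_) (Nat.le_ceil _)
      rw [hA, div_div]
      field_simp
      norm_num
    · have hw : (1 - η * Δ / 4) ^ s ≤ Q⁻¹ := by
        refine one_sub_pow_le_inv (by linarith) hQ0 ?_
        have := mul_le_mul_of_nonneg_right hs (by positivity : 0 ≤ η * Δ / 4)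
        calc Real.log Q = 4 * (1 / (η * Δ) * Real.log Q) * (η * Δ / 4) := by field_simp
          _ ≤ _ := this
      calc _ ≤ r * (200 * (c ^ 3 / Δ ^ 2) * Q⁻¹) := by gcongr
        _ = η * c * ε := by
          rw [hQ]
          field_simp
        _ ≤ ε := mul_le_of_le_one_left hε.le (by linarith)
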